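/- arXiv:2211.11985 — 4 statements merged into one kernel-verified Lean document; each statement's English description precedes it below -/
import Mathlib

section
/- Let (C, ⊗, I, c) be a braided monoidal category and let V, W be objects such that hom(U, I) exists for U = V, W, V ⊗ W, W ⊗ V. Define ξ_{V,W} : hom(V,I) ⊗ hom(W,I) → hom(W ⊗ V, I) as ξ_{V,W} = Θ_{hom(V,I)⊗hom(W,I), W⊗V, I}( ev_V ∘ (id_{hom(V,I)} ⊗ ev_W ⊗ id_V) ). Then ξ_{V,W} ∘ c_{hom(W,I),hom(V,I)} = hom(c_{W,V}, id_I) ∘ ξ_{W,V} as morphisms hom(W,I) ⊗ hom(V,I) → hom(W ⊗ V, I), where hom(c_{W,V}, id_I) : hom(V ⊗ W, I) → hom(W ⊗ V, I) is the internal-hom functoriality morphism induced by precomposition with the braiding c_{W,V} : W ⊗ V → V ⊗ W. -/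
/-!
STATEMENT 1: Let `(C, ⊗, I, c)` be a braided monoidal category and `V, W` objects such
that the internal homs `hom(U, I)` exist for `U = V, W, V ⊗ W, W ⊗ V`.  With
`ξ_{V,W} := Θ(ev_V ∘ (id ⊗ ev_W ⊗ id)) : hom(V,I) ⊗ hom(W,I) ⟶ hom(W ⊗ V, I)`, we have
`ξ_{V,W} ∘ c_{hom(W,I),hom(V,I)} = hom(c_{W,V}, id_I) ∘ ξ_{W,V}`, where
`hom(c_{W,V}, id_I) : hom(V ⊗ W, I) ⟶ hom(W ⊗ V, I)` is the internal-hom functoriality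
morphism induced by precomposition with the braiding `c_{W,V} : W ⊗ V ⟶ V ⊗ W`.
-/

open CategoryTheory MonoidalCategory

universe v u

namespace Stmt1

variable {C : Type u} [Category.{v} C] [MonoidalCategory C]

/-- An internal hom `hom(V, I)` of `V` against the monoidal unit `I`: an object
together with an isomorphism `Hom(X ⊗ V, I) ≅ Hom(X, hom(V,I))` natural in `X`. -/
structure HomData (V : C) where
  obj : C
  Θ : ∀ X : C, (X ⊗ V ⟶ 𝟙_ C) ≃ (X ⟶ obj)
  naturality : ∀ {X X' : C} (f : X' ⟶ X) (g : X ⊗ V ⟶ 𝟙_ C),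
    Θ X' ((f ▷ V) ≫ g) = f ≫ Θ X g

/-- The evaluation morphism `ev_V = Θ⁻¹(id_{hom(V,I)}) : hom(V,I) ⊗ V ⟶ I`. -/
def HomData.ev {V : C} (H : HomData V) : H.obj ⊗ V ⟶ 𝟙_ C :=
  (H.Θ H.obj).symm (𝟙 H.obj)

/-- `ξ_{V,W} : hom(V,I) ⊗ hom(W,I) ⟶ hom(W ⊗ V, I)`, given by
`ξ_{V,W} = Θ(ev_V ∘ (id_{hom(V,I)} ⊗ ev_W ⊗ id_V))`. -/
def xiMap {V W : C} (HV : HomData V) (HW : HomData W) (HWV : HomData (W ⊗ V)) :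
    HV.obj ⊗ HW.obj ⟶ HWV.obj :=
  HWV.Θ (HV.obj ⊗ HW.obj)
    ((α_ HV.obj HW.obj (W ⊗ V)).hom ≫ (HV.obj ◁ (α_ HW.obj W V).inv) ≫
      (HV.obj ◁ (HW.ev ▷ V)) ≫ (HV.obj ◁ (λ_ V).hom) ≫ HV.ev)

/-- The internal-hom functoriality morphism `hom(f, id_I) : hom(V', I) ⟶ hom(V, I)`
induced by precomposition with `f : V ⟶ V'`. -/
def homMap {V V' : C} (HV' : HomData V') (HV : HomData V) (f : V ⟶ V') :
    HV'.obj ⟶ HV.obj :=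
  HV.Θ HV'.obj ((HV'.obj ◁ f) ≫ HV'.ev)

end Stmt1

open Stmt1


theorem aux1 {C : Type u} [Category.{v} C] [MonoidalCategory C] [BraidedCategory C]
    {A B W : C} (a : A ⊗ W ⟶ 𝟙_ C) :
    (β_ A B).hom ▷ W ≫ (α_ B A W).hom ≫ B ◁ a =
      (α_ A B W).hom ≫ A ◁ (β_ W B).inv ≫ (α_ A W B).inv ≫ a ▷ B ≫ (λ_ B).hom ≫ (ρ_ B).inv := by
  have h := BraidedCategory.braiding_naturality_left a B
  rw [BraidedCategory.braiding_tensor_left_hom, braiding_tensorUnit_left] at h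
  rw [h]
  simp

theorem aux2 {C : Type u} [Category.{v} C] [MonoidalCategory C] [BraidedCategory C]
    {B V W : C} (b : B ⊗ V ⟶ 𝟙_ C) :
    B ◁ (β_ W V).hom ≫ (α_ B V W).inv ≫ b ▷ W =
      (α_ B W V).inv ≫ (β_ W B).inv ▷ V ≫ (α_ W B V).hom ≫ W ◁ b ≫ (ρ_ W).hom ≫ (λ_ W).inv := by
  have h := BraidedCategory.braiding_naturality_right W b
  rw [BraidedCategory.braiding_tensor_right_hom, braiding_tensorUnit_right] at h
  rw [h]
  simp

theorem aux3 {C : Type u} [Category.{v} C] [MonoidalCategory C] [BraidedCategory C]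
    {A B V W : C} (a : A ⊗ W ⟶ 𝟙_ C) (b : B ⊗ V ⟶ 𝟙_ C) :
    (β_ A B).hom ▷ (W ⊗ V) ≫ (α_ B A (W ⊗ V)).hom ≫ B ◁ (α_ A W V).inv ≫
        B ◁ (a ▷ V) ≫ B ◁ (λ_ V).hom ≫ b =
      (A ⊗ B) ◁ (β_ W V).hom ≫ (α_ A B (V ⊗ W)).hom ≫ A ◁ (α_ B V W).inv ≫
        A ◁ (b ▷ W) ≫ A ◁ (λ_ W).hom ≫ a := by
  have h1 := aux1 (B := B) a
  have h2 := aux2 (W := W) b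
  calc _ = (α_ (A ⊗ B) W V).inv ≫ ((β_ A B).hom ▷ W ≫ (α_ B A W).hom ≫ B ◁ a) ▷ V ≫
        (ρ_ B).hom ▷ V ≫ b := by monoidal
    _ = (α_ A B (W ⊗ V)).hom ≫ A ◁ ((α_ B W V).inv ≫ (β_ W B).inv ▷ V ≫ (α_ W B V).hom) ≫
        (α_ A W (B ⊗ V)).inv ≫ (a ▷ (B ⊗ V) ≫ (𝟙_ C) ◁ b) ≫ (λ_ (𝟙_ C)).hom := by
      rw [h1]; monoidal
    _ = (α_ A B (W ⊗ V)).hom ≫ A ◁ ((α_ B W V).inv ≫ (β_ W B).inv ▷ V ≫ (α_ W B V).hom ≫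
          W ◁ b ≫ (ρ_ W).hom ≫ (λ_ W).inv) ≫ A ◁ (λ_ W).hom ≫ a := by
      rw [← whisker_exchange]; monoidal
    _ = _ := by rw [← h2]; monoidal

theorem stmt1 {C : Type u} [Category.{v} C] [MonoidalCategory C] [BraidedCategory C]
    (V W : C) (HV : HomData V) (HW : HomData W)
    (HVW : HomData (V ⊗ W)) (HWV : HomData (W ⊗ V)) :
    (β_ HW.obj HV.obj).hom ≫ xiMap HV HW HWV =
      xiMap HW HV HVW ≫ homMap HVW HWV (β_ W V).hom := by
  have key : ∀ {U X : C} (H : HomData U) (f : X ⟶ H.obj), (H.Θ X).symm f = f ▷ U ≫ H.ev := by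
    intro U X H f
    rw [Equiv.symm_apply_eq, H.naturality]
    simp [HomData.ev]
  have h3 : xiMap HW HV HVW ▷ (W ⊗ V) ≫ HVW.obj ◁ (β_ W V).hom ≫ HVW.ev =
      (HW.obj ⊗ HV.obj) ◁ (β_ W V).hom ≫ (HVW.Θ _).symm (xiMap HW HV HVW) := by
    rw [key, whisker_exchange_assoc]
  rw [homMap, ← HWV.naturality, h3]
  unfold xiMap
  rw [← HWV.naturality, Equiv.symm_apply_apply, aux3]
end

section
/- Let k be a field of characteristic different from 2, A = k⟨x, y⟩ / ⟨yx − xy + (1/2)x²⟩ the Jordan plane with ℤ-grading (x, y of degree 1) and ℤ-action generated by σ (σ(x) = x, σ(y) = x + y). Let ε : A → k be the augmentation with ε(x) = ε(y) = 0, making k a trivial A-bimodule. Let c : A ⊗ A → A ⊗ A be the braiding determined on homogeneous elements by c(a ⊗ b) = (σ^{|a|}(b)) ⊗ a, where |a| is the internal degree of a. For A-bimodule maps ψ', φ' : A ⊗ A ⊗ A → k define the bimodule map ψ' ⌣ φ' : A ⊗ A ⊗ A ⊗ A → k by (ψ' ⌣ φ')(1 ⊗ a ⊗ b ⊗ 1)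 = φ'(1 ⊗ a ⊗ 1) ψ'(1 ⊗ b ⊗ 1). Let g_1 : A ⊗ A ⊗ A → A ⊗ V ⊗ A be the A-bimodule map determined by g_1(1 ⊗ x^k y^l ⊗ 1) = Σ_{i=0}^{k−1} x^i ⊗ x ⊗ x^{k−1−i} y^l + Σ_{j=0}^{l−1} x^k y^j ⊗ y ⊗ y^{l−1−j}, and set T = 1 ⊗ y ⊗ x ⊗ 1 − 1 ⊗ x ⊗ y ⊗ 1 + (1/2) 1 ⊗ x ⊗ x ⊗ 1 ∈ A ⊗ A ⊗ A ⊗ A. Then for all A-bimodule maps ψ, φ : A ⊗ V ⊗ A → k: ((ψ ∘ g_1) ⌣ (φ ∘ g_1))((id_A ⊗ c ⊗ id_A)(T)) = − ((ψ ∘ g_1) ⌣ (φ ∘ g_1))(T), and the right-hand side equals −( φ(1 ⊗ y ⊗ 1) ψ(1 ⊗ x ⊗ 1) − φ(1 ⊗ x ⊗ 1) ψ(1 ⊗ y ⊗ 1) + (1/2) φ(1 ⊗ x ⊗ 1) ψ(1 ⊗ x ⊗ 1) ). -/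
/-!
STATEMENT 14: Let `k` be a field with `char k ≠ 2`, `A` the Jordan plane with the
`ℤ`-grading (`x, y` of degree 1) and the `ℤ`-action generated by `σ` (`σx = x`,
`σy = x + y`), and `ε : A → k` the augmentation (`εx = εy = 0`), making `k` a trivial
`A`-bimodule.  Let `c : A ⊗ A → A ⊗ A` be the braiding with
`c(a ⊗ b) = σ^{|a|}(b) ⊗ a` on homogeneous `a`.  For `A`-bimodule maps
`ψ', φ' : A⊗A⊗A → k`, the cup product `ψ' ⌣ φ' : A⊗A⊗A⊗A → k` is the bimodule map
with `(ψ' ⌣ φ')(1⊗a⊗b⊗1) = φ'(1⊗a⊗1) ψ'(1⊗b⊗1)`.  Let `g_1 : A⊗A⊗A → A⊗V⊗A` be the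
bimodule map with `g_1(1 ⊗ x^K y^L ⊗ 1) = Σ_{i<K} x^i⊗x⊗x^{K−1−i}y^L + Σ_{j<L} x^K y^j⊗y⊗y^{L−1−j}`,
and set `T = 1⊗y⊗x⊗1 − 1⊗x⊗y⊗1 + (1/2) 1⊗x⊗x⊗1 ∈ A^{⊗4}`.  Then for all bimodule maps
`ψ, φ : A⊗V⊗A → k` (with `ψ' := ψ ∘ g_1`, `φ' := φ ∘ g_1`):
`((ψ∘g_1) ⌣ (φ∘g_1))((id ⊗ c ⊗ id)(T)) = −((ψ∘g_1) ⌣ (φ∘g_1))(T)`, and the right-hand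
side equals `−(φ(1⊗y⊗1)ψ(1⊗x⊗1) − φ(1⊗x⊗1)ψ(1⊗y⊗1) + (1/2)φ(1⊗x⊗1)ψ(1⊗x⊗1))`.
(`A⊗V⊗A` is modelled as `(A⊗A) × (A⊗A)`; the cup product is represented by any linear
map `Θ` with the prescribed values on the elements `1 ⊗ a ⊗ b ⊗ 1`.)
-/

open TensorProduct

set_option maxSynthPendingDepth 5

noncomputable section

namespace Stmt14

variable (k : Type*) [Field k]

/-- The defining relation of the Jordan plane: `yx = xy − (1/2)x²`. -/
inductive JordanRel : FreeAlgebra k (Fin 2) → FreeAlgebra k (Fin 2) → Prop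
  | rel : JordanRel (FreeAlgebra.ι k 1 * FreeAlgebra.ι k 0)
      (FreeAlgebra.ι k 0 * FreeAlgebra.ι k 1 -
        (2 : k)⁻¹ • (FreeAlgebra.ι k 0 * FreeAlgebra.ι k 0))

/-- The Jordan plane `k⟨x,y⟩ / ⟨yx − xy + (1/2)x²⟩`. -/
abbrev JordanPlane := RingQuot (JordanRel k)

/-- The generator `x` of the Jordan plane. -/
def Jx : JordanPlane k := RingQuot.mkAlgHom k (JordanRel k) (FreeAlgebra.ι k 0)

/-- The generator `y` of the Jordan plane. -/
def Jy : JordanPlane k := RingQuot.mkAlgHom k (JordanRel k) (FreeAlgebra.ι k 1)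

/-- `A ⊗ A`. -/
abbrev AA := JordanPlane k ⊗[k] JordanPlane k

/-- `A ⊗ A ⊗ A` (left-nested). -/
abbrev B1 := (JordanPlane k ⊗[k] JordanPlane k) ⊗[k] JordanPlane k

/-- `A ⊗ A ⊗ A ⊗ A` (left-nested). -/
abbrev B2 := ((JordanPlane k ⊗[k] JordanPlane k) ⊗[k] JordanPlane k) ⊗[k] JordanPlane k

/-- The degree-`n` part of the internal `ℤ`-grading of the Jordan plane: the span of
the monomials of length `n` in the generators. -/
def grade (n : ℕ) : Submodule k (JordanPlane k) :=
  Submodule.span k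
    {a | ∃ w : List (Fin 2), w.length = n ∧
      a = (w.map fun i => RingQuot.mkAlgHom k (JordanRel k) (FreeAlgebra.ι k i)).prod}

/-- The left `A`-action on the free bimodule `A⊗A⊗A`. -/
def lB (a : JordanPlane k) : B1 k →ₗ[k] B1 k :=
  TensorProduct.map (TensorProduct.map (LinearMap.mulLeft k a) LinearMap.id) LinearMap.id

/-- The right `A`-action on the free bimodule `A⊗A⊗A`. -/
def rB (b : JordanPlane k) : B1 k →ₗ[k] B1 k :=
  TensorProduct.map LinearMap.id (LinearMap.mulRight k b)

/-- The left `A`-action on `A⊗V⊗A ≅ (A⊗A) × (A⊗A)`. -/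
def lP (a : JordanPlane k) : (AA k × AA k) →ₗ[k] (AA k × AA k) :=
  LinearMap.prodMap (TensorProduct.map (LinearMap.mulLeft k a) LinearMap.id)
    (TensorProduct.map (LinearMap.mulLeft k a) LinearMap.id)

/-- The right `A`-action on `A⊗V⊗A ≅ (A⊗A) × (A⊗A)`. -/
def rP (b : JordanPlane k) : (AA k × AA k) →ₗ[k] (AA k × AA k) :=
  LinearMap.prodMap (TensorProduct.map LinearMap.id (LinearMap.mulRight k b))
    (TensorProduct.map LinearMap.id (LinearMap.mulRight k b))

/-- The prescribed value of `g_1` on the basis element `1 ⊗ x^K y^L ⊗ 1`. -/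
def g1val (K L : ℕ) : AA k × AA k :=
  (∑ i ∈ Finset.range K, (Jx k ^ i) ⊗ₜ[k] (Jx k ^ (K - 1 - i) * Jy k ^ L),
    ∑ j ∈ Finset.range L, (Jx k ^ K * Jy k ^ j) ⊗ₜ[k] (Jy k ^ (L - 1 - j)))

/-- `id_A ⊗ c ⊗ id_A : A^{⊗4} → A^{⊗4}`, `c` acting on the middle two factors. -/
def idcid (c : AA k →ₗ[k] AA k) : B2 k →ₗ[k] B2 k :=
  TensorProduct.map
    (((TensorProduct.assoc k (JordanPlane k) (JordanPlane k) (JordanPlane k)).symm.toLinearMap).comp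
      ((TensorProduct.map LinearMap.id c).comp
        (TensorProduct.assoc k (JordanPlane k) (JordanPlane k) (JordanPlane k)).toLinearMap))
    LinearMap.id

/-- `T = 1⊗y⊗x⊗1 − 1⊗x⊗y⊗1 + (1/2) 1⊗x⊗x⊗1 ∈ A^{⊗4}` (the image `f_2(1⊗r⊗1)` of the
comparison morphism). -/
def T : B2 k :=
  (((1 : JordanPlane k) ⊗ₜ[k] Jy k) ⊗ₜ[k] Jx k) ⊗ₜ[k] (1 : JordanPlane k) -
    (((1 : JordanPlane k) ⊗ₜ[k] Jx k) ⊗ₜ[k] Jy k) ⊗ₜ[k] (1 : JordanPlane k) +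
    (2 : k)⁻¹ • ((((1 : JordanPlane k) ⊗ₜ[k] Jx k) ⊗ₜ[k] Jx k) ⊗ₜ[k] (1 : JordanPlane k))

/-- `1 ⊗ x ⊗ 1` as an element of `A⊗V⊗A ≅ (A⊗A) × (A⊗A)`. -/
def ex : AA k × AA k := (((1 : JordanPlane k) ⊗ₜ[k] (1 : JordanPlane k)), 0)

/-- `1 ⊗ y ⊗ 1` as an element of `A⊗V⊗A ≅ (A⊗A) × (A⊗A)`. -/
def ey : AA k × AA k := (0, ((1 : JordanPlane k) ⊗ₜ[k] (1 : JordanPlane k)))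

end Stmt14

open Stmt14

theorem stmt14 (k : Type*) [Field k] (hchar : (2 : k) ≠ 0)
    -- the augmentation `ε` with `ε(x) = ε(y) = 0`:
    (ε : JordanPlane k →ₐ[k] k) (hεx : ε (Jx k) = 0) (hεy : ε (Jy k) = 0)
    -- the automorphism `σ` generating the `ℤ`-action:
    (σ : JordanPlane k →ₐ[k] JordanPlane k)
    (hσx : σ (Jx k) = Jx k) (hσy : σ (Jy k) = Jx k + Jy k)
    -- the braiding `c`, determined on homogeneous elements by `c(a⊗b) = σ^{|a|}(b) ⊗ a`:
    (c : AA k →ₗ[k] AA k)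
    (hc : ∀ (n : ℕ) (a b : JordanPlane k), a ∈ grade k n →
      c (a ⊗ₜ[k] b) = ((σ ^ n) b) ⊗ₜ[k] a)
    -- the `A`-bimodule comparison map `g_1` with the prescribed values:
    (g1 : B1 k →ₗ[k] (AA k × AA k))
    (hg1l : ∀ a : JordanPlane k, g1.comp (lB k a) = (lP k a).comp g1)
    (hg1r : ∀ b : JordanPlane k, g1.comp (rB k b) = (rP k b).comp g1)
    (hg1v : ∀ K L : ℕ,
      g1 ((((1 : JordanPlane k) ⊗ₜ[k] (Jx k ^ K * Jy k ^ L)) ⊗ₜ[k] (1 : JordanPlane k))) =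
        g1val k K L)
    -- `A`-bimodule maps `ψ, φ : A⊗V⊗A → k` (with `k` the trivial bimodule via `ε`):
    (ψ φ : (AA k × AA k) →ₗ[k] k)
    (hψl : ∀ (a : JordanPlane k) (m : AA k × AA k), ψ (lP k a m) = ε a * ψ m)
    (hψr : ∀ (b : JordanPlane k) (m : AA k × AA k), ψ (rP k b m) = ψ m * ε b)
    (hφl : ∀ (a : JordanPlane k) (m : AA k × AA k), φ (lP k a m) = ε a * φ m)
    (hφr : ∀ (b : JordanPlane k) (m : AA k × AA k), φ (rP k b m) = φ m * ε b)
    -- the cup product `Θ = (ψ∘g_1) ⌣ (φ∘g_1)`, with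
    -- `Θ(1⊗a⊗b⊗1) = (φ∘g_1)(1⊗a⊗1) · (ψ∘g_1)(1⊗b⊗1)`:
    (Θ : B2 k →ₗ[k] k)
    (hΘ : ∀ a b : JordanPlane k,
      Θ ((((1 : JordanPlane k) ⊗ₜ[k] a) ⊗ₜ[k] b) ⊗ₜ[k] (1 : JordanPlane k)) =
        φ (g1 (((1 : JordanPlane k) ⊗ₜ[k] a) ⊗ₜ[k] (1 : JordanPlane k))) *
          ψ (g1 (((1 : JordanPlane k) ⊗ₜ[k] b) ⊗ₜ[k] (1 : JordanPlane k)))) :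
    -- the graded braided commutativity relation on the cocycle `T`:
    Θ (idcid k c (T k)) = -Θ (T k) ∧
    -Θ (T k) =
      -(φ (ey k) * ψ (ex k) - φ (ex k) * ψ (ey k) +
        (2 : k)⁻¹ * (φ (ex k) * ψ (ex k))) := by
  have gx : g1 (((1 : JordanPlane k) ⊗ₜ[k] Jx k) ⊗ₜ[k] (1 : JordanPlane k)) = ex k := by
    have h := hg1v 1 0
    simpa [g1val, ex] using h
  have gy : g1 (((1 : JordanPlane k) ⊗ₜ[k] Jy k) ⊗ₜ[k] (1 : JordanPlane k)) = ey k := by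
    have h := hg1v 0 1
    simpa [g1val, ey] using h
  have mx : Jx k ∈ grade k 1 :=
    Submodule.subset_span ⟨[0], rfl, by simp [Jx]⟩
  have my : Jy k ∈ grade k 1 :=
    Submodule.subset_span ⟨[1], rfl, by simp [Jy]⟩
  have cyx : c (Jy k ⊗ₜ[k] Jx k) = Jx k ⊗ₜ[k] Jy k := by
    rw [hc 1 _ _ my, pow_one, hσx]
  have cxy : c (Jx k ⊗ₜ[k] Jy k) = (Jx k + Jy k) ⊗ₜ[k] Jx k := by
    rw [hc 1 _ _ mx, pow_one, hσy]
  have cxx : c (Jx k ⊗ₜ[k] Jx k) = Jx k ⊗ₜ[k] Jx k := by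
    rw [hc 1 _ _ mx, pow_one, hσx]
  have key : ∀ a b a' b' : JordanPlane k, c (a ⊗ₜ[k] b) = a' ⊗ₜ[k] b' →
      idcid k c ((((1 : JordanPlane k) ⊗ₜ[k] a) ⊗ₜ[k] b) ⊗ₜ[k] (1 : JordanPlane k)) =
        (((1 : JordanPlane k) ⊗ₜ[k] a') ⊗ₜ[k] b') ⊗ₜ[k] (1 : JordanPlane k) := by
    intro a b a' b' h
    simp only [idcid, TensorProduct.map_tmul, LinearMap.comp_apply, LinearEquiv.coe_coe,
      TensorProduct.assoc_tmul, LinearMap.id_apply, h, TensorProduct.assoc_symm_tmul]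
  have hT : Θ (T k) = φ (ey k) * ψ (ex k) - φ (ex k) * ψ (ey k) +
        (2 : k)⁻¹ * (φ (ex k) * ψ (ex k)) := by
    simp only [T, map_add, map_sub, map_smul, hΘ, gx, gy, smul_eq_mul]
  have hcT : Θ (idcid k c (T k)) = φ (ex k) * ψ (ey k) - (φ (ex k) + φ (ey k)) * ψ (ex k) +
        (2 : k)⁻¹ * (φ (ex k) * ψ (ex k)) := by
    simp only [T, map_add, map_sub, map_smul, key _ _ _ _ cyx, key _ _ _ _ cxy,
      key _ _ _ _ cxx, hΘ, gx, gy, smul_eq_mul, TensorProduct.tmul_add, TensorProduct.add_tmul, add_mul]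
  refine ⟨?_, by rw [hT]⟩
  rw [hcT, hT]
  field_simp
  ring
end
end

section
/- Let k be a field of characteristic different from 2 and let A = k⟨x, y⟩ / ⟨x², y²x − xy² − xyx⟩ be the super Jordan plane. Then there is a unique k-algebra homomorphism τ : A → A with τ(x) = −x and τ(y) = x − y, and τ is an algebra automorphism of A; consequently n ↦ τ^n defines an action of the group ℤ on A by algebra automorphisms. Moreover, the ℤ-grading of A with x, y of degree 1 (induced from word length, both relations being homogeneous) is preserved by τ. -/
/-!
STATEMENT 15: Let `k` be a field with `char k ≠ 2` and
`A = k⟨x,y⟩ / ⟨x², y²x − xy² − xyx⟩` the super Jordan plane.  There is a unique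
`k`-algebra homomorphism `τ : A → A` with `τ(x) = −x` and `τ(y) = x − y`; it is an
algebra automorphism, `n ↦ τ^n` defines an action of `ℤ` on `A` by algebra
automorphisms, and `τ` preserves the `ℤ`-grading of `A` with `x, y` of degree 1.
-/

noncomputable section

namespace Stmt15

variable (k : Type*) [Field k]

/-- The defining relations of the super Jordan plane: `x² = 0` and
`y²x = xy² + xyx` (i.e. `y²x − xy² − xyx = 0`). -/
inductive SJRel : FreeAlgebra k (Fin 2) → FreeAlgebra k (Fin 2) → Prop
  | rel1 : SJRel (FreeAlgebra.ι k 0 * FreeAlgebra.ι k 0) 0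
  | rel2 : SJRel (FreeAlgebra.ι k 1 * FreeAlgebra.ι k 1 * FreeAlgebra.ι k 0)
      (FreeAlgebra.ι k 0 * (FreeAlgebra.ι k 1 * FreeAlgebra.ι k 1) +
        FreeAlgebra.ι k 0 * FreeAlgebra.ι k 1 * FreeAlgebra.ι k 0)

/-- The super Jordan plane `k⟨x,y⟩ / ⟨x², y²x − xy² − xyx⟩`. -/
abbrev SuperJordanPlane := RingQuot (SJRel k)

/-- The generator `x` of the super Jordan plane. -/
def Sx : SuperJordanPlane k := RingQuot.mkAlgHom k (SJRel k) (FreeAlgebra.ι k 0)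

/-- The generator `y` of the super Jordan plane. -/
def Sy : SuperJordanPlane k := RingQuot.mkAlgHom k (SJRel k) (FreeAlgebra.ι k 1)

/-- The degree-`n` part of the `ℤ`-grading of the super Jordan plane (induced from
word length; both defining relations are homogeneous). -/
def sjGrade (n : ℕ) : Submodule k (SuperJordanPlane k) :=
  Submodule.span k
    {a | ∃ w : List (Fin 2), w.length = n ∧
      a = (w.map fun i => RingQuot.mkAlgHom k (SJRel k) (FreeAlgebra.ι k i)).prod}

end Stmt15

open Stmt15

namespace Stmt15

theorem hxx (k : Type*) [Field k] : Sx k * Sx k = 0 := by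
  have h := RingQuot.mkAlgHom_rel k (SJRel.rel1 (k := k))
  simpa [Sx] using h

theorem hyx (k : Type*) [Field k] :
    Sy k * Sy k * Sx k = Sx k * (Sy k * Sy k) + Sx k * Sy k * Sx k := by
  have h := RingQuot.mkAlgHom_rel k (SJRel.rel2 (k := k))
  simpa [Sx, Sy] using h

theorem sj_neg_mul (k : Type*) [Field k] (a b : SuperJordanPlane k) : -a * b = -(a * b) :=
  neg_mul a b

theorem sj_mul_neg (k : Type*) [Field k] (a b : SuperJordanPlane k) : a * -b = -(a * b) :=
  mul_neg a b

theorem sj_sub_mul (k : Type*) [Field k] (a b c : SuperJordanPlane k) :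
    (a - b) * c = a * c - b * c :=
  sub_mul a b c

/-- Abstract check of the cubic relation for `x ↦ -x`, `y ↦ z - y`, `z = ± x`. -/
theorem rel_aux {R : Type*} [Ring R] (x y z : R) (hxz : x * z = 0) (hzx : z * x = 0)
    (hzz : z * z = 0) (h : y * y * x = x * (y * y) + x * y * x)
    (hc : z * y * x = x * y * z) :
    (z - y) * (z - y) * (-x) = (-x) * ((z - y) * (z - y)) + (-x) * (z - y) * (-x) := by
  have e1 : (z - y) * (z - y) * (-x) = -(z * z * x) + z * y * x + y * (z * x) - y * y * x := by
    noncomm_ring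
  have e2 : (-x) * ((z - y) * (z - y)) + (-x) * (z - y) * (-x)
      = -(x * z * z) + x * z * y + x * y * z - x * (y * y) + x * z * x - x * y * x := by
    noncomm_ring
  rw [e1, e2, h, hxz, hzx, hzz, hc]
  simp only [zero_mul, mul_zero]
  abel

/-- The endomorphism `x ↦ -x`, `y ↦ z - y`. -/
def endo (k : Type*) [Field k] (z : SuperJordanPlane k) (hxz : Sx k * z = 0)
    (hzx : z * Sx k = 0) (hzz : z * z = 0) (hc : z * Sy k * Sx k = Sx k * Sy k * z) :
    SuperJordanPlane k →ₐ[k] SuperJordanPlane k :=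
  RingQuot.liftAlgHom k ⟨FreeAlgebra.lift k ![-Sx k, z - Sy k], by
    intro a b hab
    cases hab with
    | rel1 => simp [sj_neg_mul, sj_mul_neg, hxx]
    | rel2 =>
      simpa using rel_aux (Sx k) (Sy k) z hxz hzx hzz (hyx k) hc⟩

theorem endo_x (k : Type*) [Field k] (z : SuperJordanPlane k) (h1 h2 h3 h4) :
    endo k z h1 h2 h3 h4 (Sx k) = -Sx k := by
  rw [endo]
  conv_lhs => arg 2; rw [Sx]
  rw [RingQuot.liftAlgHom_mkAlgHom_apply]
  simp

theorem endo_y (k : Type*) [Field k] (z : SuperJordanPlane k) (h1 h2 h3 h4) :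
    endo k z h1 h2 h3 h4 (Sy k) = z - Sy k := by
  rw [endo]
  conv_lhs => arg 2; rw [Sy]
  rw [RingQuot.liftAlgHom_mkAlgHom_apply]
  simp

theorem hom_ext' (k : Type*) [Field k] (f g : SuperJordanPlane k →ₐ[k] SuperJordanPlane k)
    (hx : f (Sx k) = g (Sx k)) (hy : f (Sy k) = g (Sy k)) : f = g := by
  apply RingQuot.ringQuot_ext'
  apply FreeAlgebra.hom_ext
  funext i
  fin_cases i
  · exact hx
  · exact hy

theorem gen_mul (k : Type*) [Field k] (i : Fin 2) (n : ℕ) (a : SuperJordanPlane k)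
    (ha : a ∈ sjGrade k n) :
    RingQuot.mkAlgHom k (SJRel k) (FreeAlgebra.ι k i) * a ∈ sjGrade k (n + 1) := by
  rw [sjGrade] at ha
  induction ha using Submodule.span_induction with
  | mem a h =>
    obtain ⟨w, hw, rfl⟩ := h
    exact Submodule.subset_span ⟨i :: w, by simp [hw], by simp⟩
  | zero => rw [mul_zero]; exact Submodule.zero_mem _
  | add a b _ _ ha hb => rw [mul_add]; exact Submodule.add_mem _ ha hb
  | smul c a _ ha => rw [mul_smul_comm]; exact Submodule.smul_mem _ _ ha

theorem grade_pres (k : Type*) [Field k] (τ : SuperJordanPlane k →ₐ[k] SuperJordanPlane k)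
    (hx : τ (Sx k) = -Sx k) (hy : τ (Sy k) = Sx k - Sy k) (n : ℕ) (a : SuperJordanPlane k)
    (ha : a ∈ sjGrade k n) : τ a ∈ sjGrade k n := by
  rw [sjGrade] at ha
  induction ha using Submodule.span_induction with
  | mem a h =>
    obtain ⟨w, hw, rfl⟩ := h
    induction w generalizing n with
    | nil =>
      subst hw
      exact Submodule.subset_span ⟨[], rfl, by simp⟩
    | cons i w ih =>
      subst hw
      have h := ih w.length rfl
      rw [List.map_cons, List.prod_cons, map_mul, List.length_cons]
      have h0 := gen_mul k 0 _ _ h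
      have h1 := gen_mul k 1 _ _ h
      rw [← Sx] at h0
      rw [← Sy] at h1
      fin_cases i
      · change τ (Sx k) * _ ∈ _
        rw [hx, sj_neg_mul]
        exact Submodule.neg_mem _ h0
      · change τ (Sy k) * _ ∈ _
        rw [hy, sj_sub_mul]
        exact Submodule.sub_mem _ h0 h1
  | zero => rw [map_zero]; exact Submodule.zero_mem _
  | add a b _ _ ha hb => rw [map_add]; exact Submodule.add_mem _ ha hb
  | smul c a _ ha => rw [map_smul]; exact Submodule.smul_mem _ _ ha

end Stmt15

theorem stmt15 (k : Type*) [Field k] (hchar : (2 : k) ≠ 0) :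
    ∃ τ : SuperJordanPlane k →ₐ[k] SuperJordanPlane k,
      -- `τ` sends `x ↦ −x` and `y ↦ x − y` …
      (τ (Sx k) = -Sx k ∧ τ (Sy k) = Sx k - Sy k) ∧
      -- … and it is the unique algebra homomorphism doing so;
      (∀ f : SuperJordanPlane k →ₐ[k] SuperJordanPlane k,
        f (Sx k) = -Sx k → f (Sy k) = Sx k - Sy k → f = τ) ∧
      -- `τ` is an algebra automorphism;
      Function.Bijective τ ∧
      -- `n ↦ τ^n` is an action of the group `ℤ` on `A` by algebra automorphisms;
      (∃ Φ : Multiplicative ℤ →* (SuperJordanPlane k ≃ₐ[k] SuperJordanPlane k),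
        ∀ a : SuperJordanPlane k, Φ (Multiplicative.ofAdd 1) a = τ a) ∧
      -- `τ` preserves the `ℤ`-grading with `x, y` of degree 1:
      (∀ (n : ℕ) (a : SuperJordanPlane k), a ∈ sjGrade k n → τ a ∈ sjGrade k n) := by
  have hxx := hxx k
  let τ := endo k (Sx k) hxx hxx hxx rfl
  let σ := endo k (-Sx k) (by simp [sj_neg_mul, sj_mul_neg, hxx]) (by simp [sj_neg_mul, sj_mul_neg, hxx]) (by simp [sj_neg_mul, sj_mul_neg, hxx]) 
    (by simp [sj_neg_mul, sj_mul_neg])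
  have tx : τ (Sx k) = -Sx k := endo_x ..
  have ty : τ (Sy k) = Sx k - Sy k := endo_y ..
  have sx : σ (Sx k) = -Sx k := endo_x ..
  have sy : σ (Sy k) = -Sx k - Sy k := endo_y ..
  have hts : τ.comp σ = AlgHom.id k _ := by
    apply hom_ext'
    · simp [tx, sx]
    · simp [tx, ty, sy]
  have hst : σ.comp τ = AlgHom.id k _ := by
    apply hom_ext'
    · simp [tx, sx]
    · simp [sx, sy, ty]
  let e : SuperJordanPlane k ≃ₐ[k] SuperJordanPlane k := AlgEquiv.ofAlgHom τ σ hts hst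
  refine ⟨τ, ⟨tx, ty⟩, ?_, e.bijective, ⟨zpowersHom _ e, ?_⟩, grade_pres k τ tx ty⟩
  · intro f fx fy
    exact hom_ext' k f τ (fx.trans tx.symm) (fy.trans ty.symm)
  · intro a
    simp [zpowersHom_apply]
    rfl
end
end

section
/- Let k be a field of characteristic different from 2 and A = k⟨x, y⟩ / ⟨x², y²x − xy² − xyx⟩ the super Jordan plane. Let V_1 = k{x, y} and V_n = k{x^n, y²x^{n−1}} for n ≥ 2, and let the A-bimodule maps d_n : A ⊗ V_{n+1} ⊗ A → A ⊗ V_n ⊗ A (n ≥ 1) and d_0 : A ⊗ V_1 ⊗ A → A ⊗ A be given by the formulas: d_0(1 ⊗ v ⊗ 1) = v ⊗ 1 − 1 ⊗ v; d_1(1 ⊗ x² ⊗ 1) = 1 ⊗ x ⊗ x + x ⊗ x ⊗ 1; d_1(1 ⊗ y²x ⊗ 1) = y² ⊗ x ⊗ 1 + y ⊗ y ⊗ x + 1 ⊗ y ⊗ yx − xy ⊗ y ⊗ 1 − x ⊗ y ⊗ y − 1 ⊗ x ⊗ y² − xy ⊗ x ⊗ 1 − x ⊗ y ⊗ x − 1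 ⊗ x ⊗ yx; and for n ≥ 2, d_n(1 ⊗ x^{n+1} ⊗ 1) = x ⊗ x^n ⊗ 1 + (−1)^{n+1} 1 ⊗ x^n ⊗ x and d_n(1 ⊗ y²x^n ⊗ 1) = y² ⊗ x^n ⊗ 1 + (−1)^{n+1} 1 ⊗ y²x^{n−1} ⊗ x − x ⊗ y²x^{n−1} ⊗ 1 − xy ⊗ x^n ⊗ 1 − 1 ⊗ x^n ⊗ y² − 1 ⊗ x^n ⊗ yx. Then (A ⊗ V_• ⊗ A, d_•) is a chain complex of A-bimodules, i.e. d_{n−1} ∘ d_n = 0 for all n ≥ 1 and μ ∘ d_0 = 0 where μ : A ⊗ A → A is the multiplication. -/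
/-!
STATEMENT 17: Let `k` be a field with `char k ≠ 2` and `A` the super Jordan plane.
With `V_1 = k{x,y}`, `V_n = k{x^n, y²x^{n−1}}` (`n ≥ 2`) and the `A`-bimodule maps
`d_n : A ⊗ V_{n+1} ⊗ A → A ⊗ V_n ⊗ A` and `d_0 : A ⊗ V_1 ⊗ A → A ⊗ A` given by the
stated formulas (modelling `A ⊗ V_n ⊗ A` as `(A⊗A) × (A⊗A)`), the family
`(A ⊗ V_• ⊗ A, d_•)` is a chain complex of `A`-bimodules:
`d_{n−1} ∘ d_n = 0` for all `n ≥ 1` and `μ ∘ d_0 = 0` for the multiplication `μ`.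
-/

open TensorProduct

set_option maxSynthPendingDepth 5

noncomputable section

namespace Stmt17

variable (k : Type*) [Field k]

/-- The defining relations of the super Jordan plane: `x² = 0` and `y²x = xy² + xyx`. -/
inductive SJRel : FreeAlgebra k (Fin 2) → FreeAlgebra k (Fin 2) → Prop
  | rel1 : SJRel (FreeAlgebra.ι k 0 * FreeAlgebra.ι k 0) 0
  | rel2 : SJRel (FreeAlgebra.ι k 1 * FreeAlgebra.ι k 1 * FreeAlgebra.ι k 0)
      (FreeAlgebra.ι k 0 * (FreeAlgebra.ι k 1 * FreeAlgebra.ι k 1) +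
        FreeAlgebra.ι k 0 * FreeAlgebra.ι k 1 * FreeAlgebra.ι k 0)

/-- The super Jordan plane `k⟨x,y⟩ / ⟨x², y²x − xy² − xyx⟩`. -/
abbrev SuperJordanPlane := RingQuot (SJRel k)

/-- The generator `x`. -/
def Sx : SuperJordanPlane k := RingQuot.mkAlgHom k (SJRel k) (FreeAlgebra.ι k 0)

/-- The generator `y`. -/
def Sy : SuperJordanPlane k := RingQuot.mkAlgHom k (SJRel k) (FreeAlgebra.ι k 1)

/-- `A ⊗ A`. -/
abbrev AA := SuperJordanPlane k ⊗[k] SuperJordanPlane k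

/-- `P_n = A ⊗ V_n ⊗ A ≅ (A⊗A) × (A⊗A)` for `n ≥ 1`; the first component corresponds
to the generator `x^n` (resp. `x` for `n = 1`), the second to `y²x^{n−1}` (resp. `y`). -/
abbrev P := AA k × AA k

/-- Right multiplication by `v` on the left tensor factor. -/
def Lv (v : SuperJordanPlane k) : AA k →ₗ[k] AA k :=
  TensorProduct.map (LinearMap.mulRight k v) LinearMap.id

/-- Left multiplication by `v` on the right tensor factor. -/
def Rv (v : SuperJordanPlane k) : AA k →ₗ[k] AA k :=
  TensorProduct.map LinearMap.id (LinearMap.mulLeft k v)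

/-- Simultaneous multiplication on both factors: `a ⊗ b ↦ a·u ⊗ v·b`. -/
def LRv (u v : SuperJordanPlane k) : AA k →ₗ[k] AA k :=
  TensorProduct.map (LinearMap.mulRight k u) (LinearMap.mulLeft k v)

/-- `d_0 : P_1 → A ⊗ A`, `d_0(1⊗v⊗1) = v⊗1 − 1⊗v`. -/
def d0 : P k →ₗ[k] AA k :=
  (Lv k (Sx k) - Rv k (Sx k)).comp (LinearMap.fst k (AA k) (AA k)) +
    (Lv k (Sy k) - Rv k (Sy k)).comp (LinearMap.snd k (AA k) (AA k))

/-- `d_1 : P_2 → P_1`, with `d_1(1⊗x²⊗1) = 1⊗x⊗x + x⊗x⊗1` and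
`d_1(1⊗y²x⊗1) = y²⊗x⊗1 + y⊗y⊗x + 1⊗y⊗yx − xy⊗y⊗1 − x⊗y⊗y − 1⊗x⊗y² − xy⊗x⊗1 − x⊗y⊗x − 1⊗x⊗yx`. -/
def d1 : P k →ₗ[k] P k :=
  LinearMap.prod
    ((Rv k (Sx k) + Lv k (Sx k)).comp (LinearMap.fst k (AA k) (AA k)) +
      (Lv k (Sy k * Sy k) - Rv k (Sy k * Sy k) - Lv k (Sx k * Sy k) -
        Rv k (Sy k * Sx k)).comp (LinearMap.snd k (AA k) (AA k)))
    ((LRv k (Sy k) (Sx k) + Rv k (Sy k * Sx k) - Lv k (Sx k * Sy k) -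
        LRv k (Sx k) (Sy k) - LRv k (Sx k) (Sx k)).comp (LinearMap.snd k (AA k) (AA k)))

/-- `d_n : P_{n+1} → P_n` for `n ≥ 2`, with
`d_n(1⊗x^{n+1}⊗1) = x⊗x^n⊗1 + (−1)^{n+1} 1⊗x^n⊗x` and
`d_n(1⊗y²x^n⊗1) = y²⊗x^n⊗1 + (−1)^{n+1} 1⊗y²x^{n−1}⊗x − x⊗y²x^{n−1}⊗1 − xy⊗x^n⊗1 − 1⊗x^n⊗y² − 1⊗x^n⊗yx`. -/
def dHigh (n : ℕ) : P k →ₗ[k] P k :=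
  LinearMap.prod
    ((Lv k (Sx k) + ((-1 : k) ^ (n + 1)) • Rv k (Sx k)).comp
        (LinearMap.fst k (AA k) (AA k)) +
      (Lv k (Sy k * Sy k) - Lv k (Sx k * Sy k) - Rv k (Sy k * Sy k) -
        Rv k (Sy k * Sx k)).comp (LinearMap.snd k (AA k) (AA k)))
    ((((-1 : k) ^ (n + 1)) • Rv k (Sx k) - Lv k (Sx k)).comp
      (LinearMap.snd k (AA k) (AA k)))

/-- The multiplication `μ : A ⊗ A → A`. -/
def mulMap : AA k →ₗ[k] SuperJordanPlane k := LinearMap.mul' k (SuperJordanPlane k)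


end Stmt17

namespace Stmt17

theorem aux_xx (k : Type*) [Field k] : Sx k * Sx k = 0 := by
  have h := RingQuot.mkAlgHom_rel k (SJRel.rel1 (k := k))
  simpa only [Sx, map_mul, map_zero] using h

theorem aux_yyx (k : Type*) [Field k] :
    Sy k * (Sy k * Sx k) = Sx k * (Sy k * Sy k) + Sx k * (Sy k * Sx k) := by
  have h := RingQuot.mkAlgHom_rel k (SJRel.rel2 (k := k))
  simpa only [Sx, Sy, map_mul, map_add, mul_assoc] using h

theorem aux_xx' (k : Type*) [Field k] (b : SuperJordanPlane k) :
    Sx k * (Sx k * b) = 0 := by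
  rw [← mul_assoc, aux_xx, zero_mul]

theorem aux_yyx' (k : Type*) [Field k] (b : SuperJordanPlane k) :
    Sy k * (Sy k * (Sx k * b)) =
      Sx k * (Sy k * (Sy k * b)) + Sx k * (Sy k * (Sx k * b)) := by
  have h := congrArg (· * b) (aux_yyx k)
  simpa only [mul_assoc, add_mul] using h

theorem Lv_tmul (k : Type*) [Field k] (v a b : SuperJordanPlane k) :
    Lv k v (a ⊗ₜ b) = (a * v) ⊗ₜ b := rfl

theorem Rv_tmul (k : Type*) [Field k] (v a b : SuperJordanPlane k) :
    Rv k v (a ⊗ₜ b) = a ⊗ₜ (v * b) := rfl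

theorem LRv_tmul (k : Type*) [Field k] (u v a b : SuperJordanPlane k) :
    LRv k u v (a ⊗ₜ b) = (a * u) ⊗ₜ (v * b) := rfl

theorem mulMap_tmul (k : Type*) [Field k] (a b : SuperJordanPlane k) :
    mulMap k (a ⊗ₜ b) = a * b := rfl

/-- A linear map out of `P` vanishes if it vanishes on both kinds of pure tensors. -/
theorem P_ext (k : Type*) [Field k] {M : Type*} [AddCommGroup M] [Module k M]
    (f : P k →ₗ[k] M)
    (h1 : ∀ a b : SuperJordanPlane k, f (a ⊗ₜ b, 0) = 0)
    (h2 : ∀ a b : SuperJordanPlane k, f (0, a ⊗ₜ b) = 0) : f = 0 := by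
  apply LinearMap.prod_ext
  · exact TensorProduct.ext' (fun a b => by simpa using h1 a b)
  · exact TensorProduct.ext' (fun a b => by simpa using h2 a b)

theorem d0_apply (k : Type*) [Field k] (p q : AA k) :
    d0 k (p, q) = Lv k (Sx k) p - Rv k (Sx k) p + (Lv k (Sy k) q - Rv k (Sy k) q) := rfl

theorem d1_apply (k : Type*) [Field k] (p q : AA k) :
    d1 k (p, q) = (Rv k (Sx k) p + Lv k (Sx k) p +
      (Lv k (Sy k * Sy k) q - Rv k (Sy k * Sy k) q - Lv k (Sx k * Sy k) q -
        Rv k (Sy k * Sx k) q),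
      LRv k (Sy k) (Sx k) q + Rv k (Sy k * Sx k) q - Lv k (Sx k * Sy k) q -
        LRv k (Sx k) (Sy k) q - LRv k (Sx k) (Sx k) q) := rfl

theorem dHigh_apply (k : Type*) [Field k] (n : ℕ) (p q : AA k) :
    dHigh k n (p, q) = (Lv k (Sx k) p + ((-1 : k) ^ (n + 1)) • Rv k (Sx k) p +
      (Lv k (Sy k * Sy k) q - Lv k (Sx k * Sy k) q - Rv k (Sy k * Sy k) q -
        Rv k (Sy k * Sx k) q),
      ((-1 : k) ^ (n + 1)) • Rv k (Sx k) q - Lv k (Sx k) q) := rfl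

end Stmt17

open Stmt17

theorem stmt17 (k : Type*) [Field k] (hchar : (2 : k) ≠ 0) :
    -- `μ ∘ d_0 = 0`:
    (mulMap k).comp (d0 k) = 0 ∧
    -- `d_0 ∘ d_1 = 0`:
    (d0 k).comp (d1 k) = 0 ∧
    -- `d_1 ∘ d_2 = 0`:
    (d1 k).comp (dHigh k 2) = 0 ∧
    -- `d_n ∘ d_{n+1} = 0` for all `n ≥ 2`:
    (∀ n : ℕ, 2 ≤ n → (dHigh k n).comp (dHigh k (n + 1)) = 0) := by
  refine ⟨?_, ?_, ?_, ?_⟩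
  · apply P_ext <;> intro a b <;>
      simp only [LinearMap.comp_apply, d0_apply, map_zero, map_add, map_sub, Lv_tmul, Rv_tmul,
        mulMap_tmul, mul_assoc] <;> abel
  · apply P_ext <;> intro a b <;>
      simp only [LinearMap.comp_apply, d0_apply, d1_apply, map_zero, map_add, map_sub, Lv_tmul,
        Rv_tmul, LRv_tmul, mul_assoc, aux_xx, aux_xx', aux_yyx, aux_yyx', mul_zero, mul_add,
        tmul_add, add_tmul, tmul_zero, zero_tmul] <;> abel
  · apply P_ext <;> intro a b <;>
      simp only [LinearMap.comp_apply, dHigh_apply, d1_apply, map_zero, map_add, map_sub, Lv_tmul,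
        Rv_tmul, LRv_tmul, mul_assoc, aux_xx, aux_xx', aux_yyx, aux_yyx', mul_zero, mul_add,
        tmul_add, add_tmul, tmul_zero, zero_tmul, map_smul, smul_zero, Prod.mk_eq_zero] <;>
      norm_num <;> (try constructor) <;> abel
  · intro n _
    have hs : (-1 : k) ^ (n + 1 + 1) = -(-1 : k) ^ (n + 1) := by ring
    have hss : (-1 : k) ^ (n + 1) * (-1 : k) ^ (n + 1) = 1 := by
      rw [← mul_pow]; simp
    apply P_ext <;> intro a b <;>
      simp only [LinearMap.comp_apply, dHigh_apply, hs] <;>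
      generalize (-1 : k) ^ (n + 1) = s at hss <;>
      simp only [map_zero, map_add, map_sub, Lv_tmul, neg_smul, map_neg,
        Rv_tmul, LRv_tmul, mul_assoc, aux_xx, aux_xx', aux_yyx, aux_yyx', mul_zero, mul_add,
        tmul_add, add_tmul, tmul_zero, zero_tmul, map_smul, smul_zero, Prod.mk_eq_zero,
        smul_add, smul_sub, smul_neg, smul_smul, hss, one_smul] <;>
      (try constructor) <;> abel
end
end
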